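/- arXiv:1201.2109 — 3 statements merged into one kernel-verified Lean document; each statement's English description precedes it below -/
import Mathlib

section
/- Let u be a recurrent infinite word over A_m, let n ≥ 1, and let B ≥ n be such that every factor of u of length n is a factor of u_[B] and u_[n] is a suffix of u_[B]. Then P^rel_u(n) = { Ψ(y) − Ψ(x) : 0 ≤ j ≤ B − n, x is the prefix of length j of u_[B], and y is the prefix of length j of the word obtained from u_[B] by deleting its first n letters }. -/
/-- The prefix of length `n` of the infinite word `u`. -/
def pref (u : ℕ → ℕ) (n : ℕ) : List ℕ := (List.range n).map u

/-- `w` is a factor of the infinite word `u`. -/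
def IsFactor (u : ℕ → ℕ) (w : List ℕ) : Prop :=
  ∃ i : ℕ, w = (List.range w.length).map (fun j => u (i + j))

/-- The Parikh vector of `w`, viewed as a word over `{0, …, m-1}`. -/
def parikh (m : ℕ) (w : List ℕ) : Fin m → ℤ := fun ℓ => (w.count (ℓ : ℕ) : ℤ)

/-- The set of relative Parikh vectors of factors of `u` of length `n`. -/
def relParikhSet (m : ℕ) (u : ℕ → ℕ) (n : ℕ) : Set (Fin m → ℤ) :=
  { v | ∃ w : List ℕ, IsFactor u w ∧ w.length = n ∧ v = parikh m w - parikh m (pref u n) }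

/-- The extension of a substitution `φ` to finite words. -/
def substW (φ : ℕ → List ℕ) (w : List ℕ) : List ℕ := w.flatMap φ

/-- The `k`-th iterate of the substitution `φ`, applied to the word `w`. -/
def iterW (φ : ℕ → List ℕ) (k : ℕ) (w : List ℕ) : List ℕ := (substW φ)^[k] w

/-- `u` is recurrent: every factor occurs at infinitely many positions. -/
def Recurrent (u : ℕ → ℕ) : Prop :=
  ∀ w : List ℕ, IsFactor u w →
    ∀ N : ℕ, ∃ i, N ≤ i ∧ w = (List.range w.length).map (fun j => u (i + j))

theorem parikh_append (m : ℕ) (x y : List ℕ) :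
    parikh m (x ++ y) = parikh m x + parikh m y := by
  ext ℓ
  simp [parikh]

theorem length_pref (u : ℕ → ℕ) (n : ℕ) : (pref u n).length = n := by
  simp [pref]

theorem take_pref (u : ℕ → ℕ) {n B : ℕ} (h : n ≤ B) : (pref u B).take n = pref u n := by
  simp [pref, ← List.map_take, List.take_range, h]

theorem isFactor_take_drop_pref (u : ℕ → ℕ) (B j n : ℕ) :
    IsFactor u (((pref u B).drop j).take n) := by
  refine ⟨j, List.ext_getElem (by simp) fun k h₁ h₂ => ?_⟩
  simp [pref]

/-- The relative Parikh vector of the factor of `L` at position `j`, as a difference of prefixes. -/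
theorem parikh_take_drop_sub (m : ℕ) (L : List ℕ) (n j : ℕ) :
    parikh m ((L.drop j).take n) - parikh m (L.take n) =
      parikh m ((L.drop n).take j) - parikh m (L.take j) := by
  have h : L.take j ++ (L.drop j).take n = L.take n ++ (L.drop n).take j := by
    rw [← List.take_add, ← List.take_add, Nat.add_comm]
  have h' := congrArg (parikh m) h
  rw [parikh_append, parikh_append] at h'
  rw [sub_eq_sub_iff_add_eq_add, add_comm, h', add_comm]

theorem stmt3 (m : ℕ) (hm : 1 ≤ m) (u : ℕ → ℕ) (hu : ∀ i, u i < m)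
    (hrec : Recurrent u) (n : ℕ) (hn : 1 ≤ n) (B : ℕ) (hB : n ≤ B)
    (hBfac : ∀ w : List ℕ, IsFactor u w → w.length = n → w <:+: pref u B)
    (hBsuf : pref u n <:+ pref u B) :
    relParikhSet m u n =
      { v : Fin m → ℤ | ∃ j : ℕ, j ≤ B - n ∧
        v = parikh m (((pref u B).drop n).take j) - parikh m ((pref u B).take j) } := by
  ext v
  simp only [relParikhSet, Set.mem_ofPred_eq, ← take_pref u hB, ← parikh_take_drop_sub]
  constructor
  · rintro ⟨w, hw, hwn, rfl⟩
    obtain ⟨s, t, hst⟩ := hBfac w hw hwn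
    refine ⟨s.length, ?_, ?_⟩
    · have := congrArg List.length hst
      simp only [List.length_append, length_pref] at this
      omega
    · rw [← hst, ← hwn]
      simp
  · rintro ⟨j, hj, rfl⟩
    refine ⟨_, isFactor_take_drop_pref u B j n, ?_, rfl⟩
    rw [List.length_take, List.length_drop, length_pref]
    omega
end

section
/- Let u be the simple Parry word associated with the substitution φ, and let 0t0 be a factor of u with |t|_0 = 0. (i) If t is nonempty and its last letter is ℓ (necessarily 1 ≤ ℓ ≤ m−1), then 0t0 is a suffix of the word φ^ℓ(0)·0. (ii) If t is empty, then 00 is a suffix of φ^m(0)·0; if moreover α_0 ≥ 2, then 00 is also a prefix of u. -/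
theorem iterW_succ (φ : ℕ → List ℕ) (k : ℕ) (w : List ℕ) :
    iterW φ (k + 1) w = substW φ (iterW φ k w) :=
  Function.iterate_succ_apply' _ _ _

theorem substW_suffix {φ : ℕ → List ℕ} {v w : List ℕ} (h : v <:+ w) :
    substW φ v <:+ substW φ w := by
  obtain ⟨r, rfl⟩ := h
  exact ⟨substW φ r, by simp [substW]⟩

theorem pref_append (u : ℕ → ℕ) (a b : ℕ) :
    pref u a ++ (List.range b).map (fun j => u (a + j)) = pref u (a + b) := by
  simp [pref, List.range_add, Function.comp_def]

theorem pref_prefix (u : ℕ → ℕ) {a b : ℕ} (h : a ≤ b) : pref u a <+: pref u b := by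
  obtain ⟨c, rfl⟩ := Nat.exists_eq_add_of_le h
  exact ⟨_, pref_append u a c⟩

/-- A substitution on `{0, …, m-1}` of simple Parry shape: each letter `ℓ < m - 1` is sent to a
block of zeros followed by `ℓ + 1`, and the last letter to a block of zeros. -/
structure IsParrySubst (m : ℕ) (α : ℕ → ℕ) (φ : ℕ → List ℕ) : Prop where
  eq_of_lt : ∀ ℓ, ℓ + 1 < m → φ ℓ = List.replicate (α ℓ) 0 ++ [ℓ + 1]
  eq_last : φ (m - 1) = List.replicate (α (m - 1)) 0

namespace IsParrySubst

variable {m : ℕ} {α : ℕ → ℕ} {φ : ℕ → List ℕ}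

/-- A prefix of `φ a` that ends with the nonzero letter `ℓ + 1` is all of `φ a`, and `a = ℓ`. -/
theorem eq_of_prefix (hφ : IsParrySubst m α φ) {a ℓ : ℕ} (ha : a < m) {P : List ℕ}
    (h : P ++ [ℓ + 1] <+: φ a) : a = ℓ ∧ P ++ [ℓ + 1] = φ a := by
  have hmem : ℓ + 1 ∈ φ a := h.subset (by simp)
  by_cases ham : a + 1 < m
  · rw [hφ.eq_of_lt a ham] at h hmem ⊢
    have hal : a = ℓ := by
      simp only [List.mem_append, List.mem_replicate, List.mem_singleton] at hmem
      omega
    refine ⟨hal, ?_⟩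
    rcases List.prefix_concat_iff.1 h with h | h
    · exact h
    · have : ℓ + 1 ∈ List.replicate (α a) 0 := h.subset (by simp)
      simp [List.mem_replicate] at this
  · obtain rfl : a = m - 1 := by omega
    rw [hφ.eq_last] at hmem
    simp [List.mem_replicate] at hmem

/-- Desubstitution: a prefix of `φ(W)` ending with `ℓ + 1` is the image of a prefix of `W` ending
with `ℓ`. -/
theorem exists_prefix_substW (hφ : IsParrySubst m α φ) {ℓ : ℕ} :
    ∀ (W P : List ℕ), (∀ a ∈ W, a < m) → P ++ [ℓ + 1] <+: substW φ W →
      ∃ Q, Q ++ [ℓ] <+: W ∧ P ++ [ℓ + 1] = substW φ (Q ++ [ℓ]) := by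
  intro W
  induction W with
  | nil => intro P _ h; simp [substW] at h
  | cons a W ih =>
    intro P hW h
    have hsub : substW φ (a :: W) = φ a ++ substW φ W := by simp [substW]
    have whole (h : P ++ [ℓ + 1] <+: φ a) :
        ∃ Q, Q ++ [ℓ] <+: a :: W ∧ P ++ [ℓ + 1] = substW φ (Q ++ [ℓ]) := by
      obtain ⟨rfl, h⟩ := hφ.eq_of_prefix (hW a (by simp)) h
      exact ⟨[], by simp, by simpa [substW] using h⟩
    rw [hsub] at h
    rcases List.prefix_or_prefix_of_prefix h (List.prefix_append (φ a) (substW φ W)) with h1 | h1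
    · exact whole h1
    · obtain ⟨R, hR⟩ := h1
      rcases R.eq_nil_or_concat with rfl | ⟨R, b, rfl⟩
      · exact whole (by simp [← hR])
      · rw [List.concat_eq_append, ← List.append_assoc] at hR
        obtain ⟨rfl, hb⟩ := List.append_inj' hR rfl
        obtain rfl : b = ℓ + 1 := by simpa using hb
        rw [List.append_assoc, List.prefix_append_right_inj] at h
        obtain ⟨Q, hQ, hE⟩ := ih R (fun c hc => hW c (by simp [hc])) h
        refine ⟨a :: Q, by simpa using hQ, ?_⟩
        rw [List.append_assoc, hE]
        simp [substW]

/-- Every prefix of an iterate of `φ` that ends with the letter `ℓ` has `φ^ℓ(0)` as a suffix. -/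
theorem iterW_suffix_of_prefix (hφ : IsParrySubst m α φ)
    (hlt : ∀ k, ∀ a ∈ iterW φ k [0], a < m) :
    ∀ (ℓ k : ℕ) (P : List ℕ), P ++ [ℓ] <+: iterW φ k [0] → iterW φ ℓ [0] <:+ P ++ [ℓ] := by
  intro ℓ
  induction ℓ with
  | zero => intro k P _; simp [iterW]
  | succ ℓ ih =>
    intro k P h
    cases k with
    | zero =>
      have : ℓ + 1 ∈ [0] := h.subset (by simp)
      simp at this
    | succ k =>
      rw [iterW_succ] at h
      obtain ⟨Q, hQ, hE⟩ := hφ.exists_prefix_substW _ _ (hlt k) h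
      rw [iterW_succ, hE]
      exact substW_suffix (ih k Q hQ)

theorem exists_iterW_eq_append (hφ : IsParrySubst m α φ) :
    ∀ ℓ, ℓ < m → ∃ P, iterW φ ℓ [0] = P ++ [ℓ] := by
  intro ℓ
  induction ℓ with
  | zero => intro _; exact ⟨[], rfl⟩
  | succ ℓ ih =>
    intro h
    obtain ⟨P, hP⟩ := ih (by omega)
    refine ⟨substW φ P ++ List.replicate (α ℓ) 0, ?_⟩
    rw [iterW_succ, hP]
    simp [substW, hφ.eq_of_lt ℓ h]

theorem zero_mem_iterW (hφ : IsParrySubst m α φ) (hm : 2 ≤ m) (hα0 : 1 ≤ α 0) (k : ℕ) :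
    0 ∈ iterW φ k [0] := by
  induction k with
  | zero => simp [iterW]
  | succ k ih =>
    rw [iterW_succ, substW, List.mem_flatMap]
    refine ⟨0, ih, ?_⟩
    rw [hφ.eq_of_lt 0 (by omega)]
    simp
    omega

theorem length_add_count_le (hφ : IsParrySubst m α φ) (hm : 2 ≤ m) (hα0 : 1 ≤ α 0)
    (hαlast : 1 ≤ α (m - 1)) (W : List ℕ) (hW : ∀ a ∈ W, a < m) :
    W.length + W.count 0 ≤ (substW φ W).length := by
  induction W with
  | nil => simp
  | cons a W ih =>
    have ih := ih (fun c hc => hW c (by simp [hc]))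
    have ha : a < m := hW a (by simp)
    have hsub : substW φ (a :: W) = φ a ++ substW φ W := by simp [substW]
    have hone : 1 ≤ (φ a).length := by
      by_cases h : a + 1 < m
      · simp [hφ.eq_of_lt a h]
      · obtain rfl : a = m - 1 := by omega
        simpa [hφ.eq_last] using hαlast
    rw [hsub, List.length_append, List.length_cons]
    by_cases h0 : a = 0
    · subst h0
      have : 2 ≤ (φ 0).length := by simp [hφ.eq_of_lt 0 (by omega)]; omega
      rw [List.count_cons_self]
      omega
    · rw [List.count_cons_of_ne h0]
      omega

theorem le_length_iterW (hφ : IsParrySubst m α φ) (hm : 2 ≤ m) (hα0 : 1 ≤ α 0)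
    (hαlast : 1 ≤ α (m - 1)) (hlt : ∀ k, ∀ a ∈ iterW φ k [0], a < m) (k : ℕ) :
    k ≤ (iterW φ k [0]).length := by
  induction k with
  | zero => simp
  | succ k ih =>
    have h1 := hφ.length_add_count_le hm hα0 hαlast _ (hlt k)
    have h2 := List.count_pos_iff.2 (hφ.zero_mem_iterW hm hα0 k)
    rw [iterW_succ]
    omega

end IsParrySubst

theorem stmt6
    (m : ℕ) (hm : 2 ≤ m) (α : ℕ → ℕ) (hα0 : 1 ≤ α 0)
    (hαle : ∀ ℓ, ℓ < m → α ℓ ≤ α 0) (hαlast : 1 ≤ α (m - 1))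
    (φ : ℕ → List ℕ)
    (hφ : ∀ ℓ, ℓ + 1 < m → φ ℓ = List.replicate (α ℓ) 0 ++ [ℓ + 1])
    (hφlast : φ (m - 1) = List.replicate (α (m - 1)) 0)
    (u : ℕ → ℕ) (hu : ∀ i, u i < m)
    (hufix : ∀ k : ℕ, iterW φ k [0] = pref u (iterW φ k [0]).length)
    (t : List ℕ) (ht0 : t.count 0 = 0) (hfac : IsFactor u ([0] ++ t ++ [0])) :
    (∀ hne : t ≠ [], ([0] ++ t ++ [0]) <:+ (iterW φ (t.getLast hne) [0] ++ [0])) ∧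
    (t = [] →
      ([0, 0] <:+ (iterW φ m [0] ++ [0])) ∧
      (2 ≤ α 0 → [0, 0] = pref u 2)) := by
  have hP : IsParrySubst m α φ := ⟨hφ, hφlast⟩
  have hlt : ∀ k, ∀ a ∈ iterW φ k [0], a < m := by
    intro k a ha
    rw [hufix k, pref, List.mem_map] at ha
    obtain ⟨i, _, rfl⟩ := ha
    exact hu i
  have hpre : ∀ n, pref u n <+: iterW φ n [0] := by
    intro n
    rw [hufix n]
    exact pref_prefix u (hP.le_length_iterW hm hα0 hαlast hlt n)
  refine ⟨fun hne => ?_, fun _ => ⟨?_, fun h2 => ?_⟩⟩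
  · obtain ⟨i, hi⟩ := hfac
    have hfull := hpre (i + ([0] ++ t ++ [0]).length)
    rw [← pref_append, ← hi, ← List.append_assoc] at hfull
    have hsplit : pref u i ++ ([0] ++ t) =
        (pref u i ++ [0] ++ t.dropLast) ++ [t.getLast hne] := by
      simp [List.dropLast_append_getLast]
    have hsuf : iterW φ (t.getLast hne) [0] <:+ pref u i ++ ([0] ++ t) := by
      rw [hsplit]
      refine hP.iterW_suffix_of_prefix hlt _ (i + ([0] ++ t ++ [0]).length) _ ?_
      rw [← hsplit]
      exact (List.prefix_append _ _).trans hfull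
    have key : [0] ++ t <:+ iterW φ (t.getLast hne) [0] := by
      rcases List.suffix_or_suffix_of_suffix hsuf (List.suffix_append _ _) with h | h
      · rcases List.suffix_cons_iff.1 h with h | h
        · exact h ▸ List.suffix_rfl
        · exact absurd (h.subset (hP.zero_mem_iterW hm hα0 _)) (List.count_eq_zero.1 ht0)
      · exact h
    obtain ⟨r, hr⟩ := key
    exact ⟨r, by rw [← hr]; simp⟩
  · obtain ⟨Q, hQ⟩ := hP.exists_iterW_eq_append (m - 1) (by omega)
    obtain ⟨c, hc⟩ := Nat.exists_eq_add_of_le' hαlast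
    have hm1 : m = m - 1 + 1 := by omega
    refine ⟨substW φ Q ++ List.replicate c 0, ?_⟩
    rw [show iterW φ m [0] = substW φ (iterW φ (m - 1) [0]) by rw [← iterW_succ, ← hm1], hQ]
    simp [substW, hφlast, hc, List.replicate_succ']
  · obtain ⟨c, hc⟩ := Nat.exists_eq_add_of_le' h2
    have h1 : iterW φ 1 [0] = [0, 0] ++ (List.replicate c 0 ++ [1]) := by
      simp [iterW, substW, hφ 0 (by omega), hc, List.replicate_succ]
    have hp : [0, 0] <+: iterW φ 1 [0] := h1 ▸ List.prefix_append _ _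
    have hq : pref u 2 <+: iterW φ 1 [0] := by
      rw [hufix 1]
      exact pref_prefix u (by simpa using hp.length_le)
    exact (List.prefix_of_prefix_length_le hp hq (by simp [pref])).eq_of_length (by simp [pref])
end

section
/- Let u be the simple Parry word associated with the substitution φ, and let R_s = m−1 if α_0 ≥ 2 and R_s = m + ℓ′ − 1 with ℓ′ = min{ℓ ≥ 1 : α_ℓ ≥ 1} if α_0 = 1. Then for every n ≥ 1 and every k ∈ ℕ with n ≤ F_k, the word φ^{k+R_s}(0)·u_[n] is a prefix of u and every factor of u of length n is a factor of φ^{k+R_s}(0)·u_[n]. -/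
namespace SimpleParryWord

section Words

variable {φ : ℕ → List ℕ} {u : ℕ → ℕ}

@[simp] lemma length_pref (u : ℕ → ℕ) (n : ℕ) : (pref u n).length = n := by simp [pref]

lemma pref_add (u : ℕ → ℕ) (p n : ℕ) :
    pref u (p + n) = pref u p ++ (List.range n).map (fun j => u (p + j)) := by
  simp [pref, List.range_add, Function.comp_def]

lemma pref_prefix {a b : ℕ} (h : a ≤ b) : pref u a <+: pref u b := by
  obtain ⟨c, rfl⟩ := Nat.exists_eq_add_of_le h
  exact ⟨_, (pref_add u a c).symm⟩

lemma eq_pref_of_prefix {v : List ℕ} {n : ℕ} (h : v <+: pref u n) : v = pref u v.length := by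
  have hle : v.length ≤ n := by simpa using h.length_le
  exact (List.prefix_of_prefix_length_le h (pref_prefix hle) (by simp)).eq_of_length (by simp)

@[simp] lemma substW_append (v w : List ℕ) : substW φ (v ++ w) = substW φ v ++ substW φ w := by
  simp [substW]

@[simp] lemma substW_nil : substW φ [] = [] := rfl

@[simp] lemma substW_cons (a : ℕ) (w : List ℕ) : substW φ (a :: w) = φ a ++ substW φ w := by
  simp [substW]

lemma iterW_add (a b : ℕ) (w : List ℕ) : iterW φ (a + b) w = iterW φ a (iterW φ b w) :=
  Function.iterate_add_apply _ _ _ _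

lemma iterW_succ (k : ℕ) (w : List ℕ) : iterW φ (k + 1) w = substW φ (iterW φ k w) :=
  Function.iterate_succ_apply' _ _ _

@[simp] lemma iterW_one (w : List ℕ) : iterW φ 1 w = substW φ w := rfl

@[simp] lemma iterW_zero (w : List ℕ) : iterW φ 0 w = w := rfl

@[simp] lemma iterW_nil (k : ℕ) : iterW φ k [] = [] :=
  Function.iterate_fixed rfl k

@[simp] lemma iterW_append (k : ℕ) (v w : List ℕ) :
    iterW φ k (v ++ w) = iterW φ k v ++ iterW φ k w := by
  induction k with
  | zero => rfl
  | succ k ih => simp [iterW_succ, ih]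

/-- The word `v` occurs in `u` at position `p`. -/
def OccursAt (u : ℕ → ℕ) (p : ℕ) (v : List ℕ) : Prop :=
  pref u p ++ v = pref u (p + v.length)

lemma OccursAt.left {p : ℕ} {v w : List ℕ} (h : OccursAt u p (v ++ w)) : OccursAt u p v := by
  have h' : pref u p ++ v <+: pref u (p + (v ++ w).length) := ⟨w, by simpa [OccursAt] using h⟩
  simpa [OccursAt] using eq_pref_of_prefix h'

lemma OccursAt.right {p : ℕ} {v w : List ℕ} (h : OccursAt u p (v ++ w)) :
    OccursAt u (p + v.length) w := by
  have hl : pref u p ++ v = pref u (p + v.length) := h.left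
  unfold OccursAt at h ⊢
  rw [← hl, List.append_assoc, h, List.length_append, Nat.add_assoc]

lemma OccursAt.mid {p : ℕ} {x v y : List ℕ} (h : OccursAt u p (x ++ v ++ y)) :
    OccursAt u (p + x.length) v :=
  h.left.right

lemma occursAt_map_range (u : ℕ → ℕ) (p n : ℕ) :
    OccursAt u p ((List.range n).map fun j => u (p + j)) := by
  simp [OccursAt, pref_add]

lemma OccursAt.eq_of_length {p : ℕ} {v w : List ℕ} (hv : OccursAt u p v) (hw : OccursAt u p w)
    (h : v.length = w.length) : v = w := by
  unfold OccursAt at hv hw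
  rw [h, ← hw] at hv
  exact List.append_cancel_left hv

lemma occursAt_zero {v : List ℕ} : OccursAt u 0 v ↔ v = pref u v.length := by
  simp [OccursAt, pref]

lemma occursAt_cons {p a : ℕ} {v : List ℕ} :
    OccursAt u p (a :: v) ↔ u p = a ∧ OccursAt u (p + 1) v := by
  constructor
  · intro h
    have h1 : OccursAt u p [a] := OccursAt.left (v := [a]) (w := v) h
    refine ⟨?_, OccursAt.right (v := [a]) (w := v) h⟩
    have := h1.eq_of_length (occursAt_map_range u p 1) (by simp)
    simpa using this.symm
  · rintro ⟨rfl, h⟩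
    unfold OccursAt at h ⊢
    have e : pref u (p + 1) = pref u p ++ [u p] := by simp [pref_add]
    rw [e] at h
    simpa [Nat.add_assoc, Nat.add_comm 1] using h

lemma OccursAt.getElem? {p i : ℕ} {v : List ℕ} (h : OccursAt u p v) (hi : i < v.length) :
    v[i]? = some (u (p + i)) := by
  rw [h.eq_of_length (occursAt_map_range u p v.length) (by simp)]
  simp [hi]

end Words

/-- The word `u` is the simple Parry word of the substitution `φ` with parameters `α`. -/
structure IsSimpleParry (m : ℕ) (α : ℕ → ℕ) (φ : ℕ → List ℕ) (u : ℕ → ℕ) : Prop where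
  two_le : 2 ≤ m
  zero_pos : 1 ≤ α 0
  last_pos : 1 ≤ α (m - 1)
  phi : ∀ ℓ, ℓ + 1 < m → φ ℓ = List.replicate (α ℓ) 0 ++ [ℓ + 1]
  phi_last : φ (m - 1) = List.replicate (α (m - 1)) 0
  lt : ∀ i, u i < m
  iter_eq : ∀ k : ℕ, iterW φ k [0] = pref u (iterW φ k [0]).length

/-- The relation satisfied by two consecutive letters `a x` of a simple Parry word, `x ≠ 0`. -/
def Succeeds (α : ℕ → ℕ) (a x : ℕ) : Prop :=
  a < x ∧ 1 ≤ α (x - a - 1) ∧ ∀ j, x - a ≤ j → j < x → α j = 0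

/-- Every chain of consecutive nonzero letters ending in `s` (with an arbitrary first letter),
followed by `0`, occurs in `u` starting inside `φ^t(0)`. -/
def ChainsOccur (m : ℕ) (α : ℕ → ℕ) (φ : ℕ → List ℕ) (u : ℕ → ℕ) (s t : ℕ) : Prop :=
  ∀ l : List ℕ, l.IsChain (Succeeds α) → (∀ y ∈ l, y < m) → l.getLast? = some s →
    ∃ p < (iterW φ t [0]).length, OccursAt u p (l ++ [0])

section Chains

variable {α : ℕ → ℕ}

lemma Succeeds.pred {a x : ℕ} (h : Succeeds α (a + 1) x) : Succeeds α a (x - 1) := by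
  obtain ⟨h1, h2, h3⟩ := h
  refine ⟨by omega, ?_, fun j hj hj' => h3 j (by omega) (by omega)⟩
  rwa [show x - 1 - a - 1 = x - (a + 1) - 1 by omega]

lemma Succeeds.alpha_pred {a x : ℕ} (h : Succeeds α (a + 1) x) : α (x - 1) = 0 :=
  h.2.2 _ (by omega) (by have := h.1; omega)

lemma isChain_pred {l : List ℕ} : ∀ {a : ℕ}, ((a + 1) :: l).IsChain (Succeeds α) →
    (a :: l.map (· - 1)).IsChain (Succeeds α) := by
  induction l with
  | nil => intros; simp
  | cons x l ih =>
    intro a h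
    rw [List.isChain_cons_cons] at h
    rw [List.map_cons, List.isChain_cons_cons]
    refine ⟨h.1.pred, ih ?_⟩
    rw [Nat.sub_add_cancel (by have := h.1.1; omega)]
    exact h.2

lemma head_add_length_le {s : ℕ} {l : List ℕ} : ∀ {a : ℕ}, (a :: l).IsChain (Succeeds α) →
    (a :: l).getLast? = some s → a + l.length ≤ s := by
  induction l with
  | nil => intro a _ h; simp at h; simp [h]
  | cons x l ih =>
    intro a h hs
    rw [List.isChain_cons_cons] at h
    rw [List.getLast?_cons_cons] at hs
    have := ih h.2 hs
    have := h.1.1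
    simp; omega

lemma eq_range' {e : ℕ} (he : ∀ j, 1 ≤ j → j < e → α j = 0) {l : List ℕ} :
    ∀ {a : ℕ}, (a :: l).IsChain (Succeeds α) → (a :: l).getLast? = some e →
      a :: l = List.range' a (e + 1 - a) := by
  induction l with
  | nil => intro a _ h; simp at h; simp [h]
  | cons x l ih =>
    intro a h hs
    have hle := head_add_length_le h hs
    rw [List.isChain_cons_cons] at h
    rw [List.getLast?_cons_cons] at hs
    have hle' := head_add_length_le h.2 hs
    obtain ⟨h1, h2, -⟩ := h.1
    have hx : x = a + 1 := by
      by_contra hne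
      have := he (x - a - 1) (by omega) (by omega)
      omega
    subst hx
    rw [ih h.2 hs, show e + 1 - a = (e + 1 - (a + 1)) + 1 by simp at hle; omega]
    rfl

end Chains

namespace IsSimpleParry

variable {m : ℕ} {α : ℕ → ℕ} {φ : ℕ → List ℕ} {u : ℕ → ℕ}

lemma phi_zero (H : IsSimpleParry m α φ u) : ∃ v, φ 0 = 0 :: v ∧ v ≠ [] := by
  rw [H.phi 0 (by have := H.two_le; omega)]
  obtain ⟨c, hc⟩ := Nat.exists_eq_add_of_le' H.zero_pos
  exact ⟨List.replicate c 0 ++ [1], by simp [hc, List.replicate_succ], by simp⟩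

lemma phi_eq_zero_cons (H : IsSimpleParry m α φ u) {ℓ : ℕ} (hℓ : ℓ < m) (h : 1 ≤ α ℓ) :
    ∃ v, φ ℓ = 0 :: v := by
  obtain ⟨c, hc⟩ := Nat.exists_eq_add_of_le' h
  rcases Nat.lt_or_ge (ℓ + 1) m with h1 | h1
  · rw [H.phi ℓ h1, hc]
    exact ⟨_, by rw [List.replicate_succ, List.cons_append]⟩
  · obtain rfl : ℓ = m - 1 := by omega
    rw [H.phi_last, hc]
    exact ⟨_, List.replicate_succ⟩

lemma phi_ne_nil (H : IsSimpleParry m α φ u) {ℓ : ℕ} (hℓ : ℓ < m) : φ ℓ ≠ [] := by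
  rcases Nat.lt_or_ge (ℓ + 1) m with h1 | h1
  · simp [H.phi ℓ h1]
  · obtain rfl : ℓ = m - 1 := by omega
    have := H.last_pos
    rw [H.phi_last]; simp; omega

lemma mem_pref_lt (H : IsSimpleParry m α φ u) {n y : ℕ} (hy : y ∈ pref u n) : y < m := by
  simp only [pref, List.mem_map] at hy
  obtain ⟨i, -, rfl⟩ := hy
  exact H.lt i

lemma length_le_substW (H : IsSimpleParry m α φ u) {w : List ℕ} (hw : ∀ y ∈ w, y < m) :
    w.length ≤ (substW φ w).length := by
  induction w with
  | nil => simp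
  | cons a w ih =>
    have := ih fun y hy => hw y (by simp [hy])
    have := List.length_pos_of_ne_nil (H.phi_ne_nil (hw a (by simp)))
    simp; omega

lemma zero_eq (H : IsSimpleParry m α φ u) : u 0 = 0 := by
  have := H.iter_eq 0
  simpa [pref] using this.symm

lemma lt_length_iter (H : IsSimpleParry m α φ u) (k : ℕ) : k < (iterW φ k [0]).length := by
  induction k with
  | zero => simp
  | succ k ih =>
    have h := H.iter_eq k
    obtain ⟨n, hn⟩ := Nat.exists_eq_add_of_le' (Nat.zero_lt_of_lt ih)
    rw [hn, Nat.add_comm, Nat.succ_eq_add_one, Nat.zero_add, pref_add] at h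
    have hp : pref u 1 = [0] := by simp [pref, H.zero_eq]
    rw [hp] at h
    rw [h] at ih
    rw [iterW_succ, h]
    obtain ⟨v, hv, hv'⟩ := H.phi_zero
    have := List.length_pos_of_ne_nil hv'
    have := H.length_le_substW (w := (List.range n).map fun j => u (1 + j)) (by
      intro y hy
      simp only [List.mem_map] at hy
      obtain ⟨i, -, rfl⟩ := hy
      exact H.lt _)
    simp [hv] at ih this ⊢
    omega

lemma substW_pref (H : IsSimpleParry m α φ u) (n : ℕ) :
    substW φ (pref u n) = pref u (substW φ (pref u n)).length := by
  have h : pref u n <+: iterW φ n [0] := by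
    rw [H.iter_eq n]; exact pref_prefix (H.lt_length_iter n).le
  obtain ⟨t, ht⟩ := h
  apply eq_pref_of_prefix (n := (iterW φ (n + 1) [0]).length)
  rw [← H.iter_eq, iterW_succ, ← ht, substW_append]
  exact List.prefix_append _ _

lemma iterW_pref (H : IsSimpleParry m α φ u) (k n : ℕ) :
    iterW φ k (pref u n) = pref u (iterW φ k (pref u n)).length := by
  induction k with
  | zero => simp
  | succ k ih => rw [iterW_succ, ih]; exact H.substW_pref _

lemma occursAt_iterW (H : IsSimpleParry m α φ u) {p : ℕ} {v : List ℕ} (h : OccursAt u p v)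
    (k : ℕ) : OccursAt u (iterW φ k (pref u p)).length (iterW φ k v) := by
  unfold OccursAt at h ⊢
  rw [← H.iterW_pref, ← iterW_append, ← List.length_append, ← iterW_append, h]
  exact H.iterW_pref _ _

lemma length_iterW_pref_lt (H : IsSimpleParry m α φ u) {p t o : ℕ} {a : ℕ} (ha : u p = a)
    (hp : p < (iterW φ t [0]).length) (k : ℕ) (ho : o < (iterW φ k [a]).length) :
    (iterW φ k (pref u p)).length + o < (iterW φ (k + t) [0]).length := by
  obtain ⟨v, hv⟩ := pref_prefix (u := u) (Nat.succ_le_of_lt hp)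
  rw [← H.iter_eq, Nat.succ_eq_add_one, pref_add] at hv
  rw [iterW_add, ← hv, iterW_append, iterW_append]
  simp [ha]
  omega

lemma length_iter_mono (H : IsSimpleParry m α φ u) :
    Monotone fun k => (iterW φ k [0]).length := by
  refine monotone_nat_of_le_succ fun k => ?_
  rw [iterW_succ]
  refine H.length_le_substW fun y hy => ?_
  rw [H.iter_eq] at hy
  exact H.mem_pref_lt hy

lemma chainsOccur_mono (H : IsSimpleParry m α φ u) {s t t' : ℕ} (h : ChainsOccur m α φ u s t)
    (ht : t ≤ t') : ChainsOccur m α φ u s t' := by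
  intro l h1 h2 h3
  obtain ⟨p, hp, hp'⟩ := h l h1 h2 h3
  exact ⟨p, hp.trans_le (H.length_iter_mono ht), hp'⟩

lemma occursAt_substW_mid (H : IsSimpleParry m α φ u) {p t a : ℕ} {v x w y : List ℕ}
    (hp : p < (iterW φ t [0]).length) (h : OccursAt u p (a :: v))
    (hxwy : substW φ (a :: v) = x ++ w ++ y) (hx : x.length < (φ a).length) :
    ∃ q < (iterW φ (t + 1) [0]).length, OccursAt u q w := by
  have h1 := H.occursAt_iterW h 1
  rw [iterW_one, iterW_one, hxwy] at h1
  refine ⟨_, ?_, h1.mid⟩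
  have := H.length_iterW_pref_lt (occursAt_cons.1 h).1 hp 1 (o := x.length) (by simpa using hx)
  rwa [Nat.add_comm 1 t] at this

lemma substW_map_pred (H : IsSimpleParry m α φ u) {l : List ℕ} : ∀ {a : ℕ},
    ((a + 1) :: l).IsChain (Succeeds α) → (∀ y ∈ l, y < m) → substW φ (l.map (· - 1)) = l := by
  induction l with
  | nil => intros; simp
  | cons x l ih =>
    intro a h hm
    rw [List.isChain_cons_cons] at h
    have hx := h.1.1
    have e : x - 1 + 1 = x := by omega
    have h' := h.2
    rw [← e] at h'
    have hlt := hm x (by simp)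
    rw [List.map_cons, substW_cons, ih h' fun y hy => hm y (by simp [hy]),
      H.phi _ (by omega), h.1.alpha_pred, e]
    simp

lemma chainsOccur_succ (H : IsSimpleParry m α φ u) {s t : ℕ} (h : ChainsOccur m α φ u s t) :
    ChainsOccur m α φ u (s + 1) (t + 1) := by
  obtain ⟨z, hz, -⟩ := H.phi_zero
  have key : ∀ a l, ((a + 1) :: l).IsChain (Succeeds α) → (∀ y ∈ (a + 1) :: l, y < m) →
      ((a + 1) :: l).getLast? = some (s + 1) →
      ∃ p < (iterW φ t [0]).length, OccursAt u p (a :: (l.map (· - 1) ++ [0])) ∧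
        substW φ (a :: (l.map (· - 1) ++ [0])) =
          List.replicate (α a) 0 ++ ((a + 1) :: l ++ [0]) ++ z := by
    intro a l hc hm hs
    obtain ⟨p, hp, ho⟩ := h (a :: l.map (· - 1)) (isChain_pred hc) (by
      intro y hy
      simp only [List.mem_cons, List.mem_map] at hy hm
      rcases hy with rfl | ⟨x, hx, rfl⟩
      · have := hm (y + 1) (Or.inl rfl); omega
      · have := hm x (Or.inr hx); omega) (by
      have := congrArg (Option.map (· - 1)) hs
      rw [← List.getLast?_map] at this
      simpa using this)
    refine ⟨p, hp, ho, ?_⟩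
    rw [substW_cons, substW_append, H.substW_map_pred hc fun y hy => hm y (by simp [hy]),
      H.phi a (hm _ (by simp)), substW_cons, hz]
    simp
  intro l hc hm hs
  rcases l with _ | ⟨a, l⟩
  · simp at hs
  rcases a with _ | a
  · rcases l with _ | ⟨x, l⟩
    · simp at hs
    rw [List.isChain_cons_cons] at hc
    rw [List.getLast?_cons_cons] at hs
    obtain ⟨⟨hx, hα, -⟩, hc⟩ := hc
    obtain ⟨x, rfl⟩ := Nat.exists_eq_add_of_le' hx
    obtain ⟨c, hcα⟩ := Nat.exists_eq_add_of_le' hα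
    obtain ⟨p, hp, ho, he⟩ := key x l hc (fun y hy => hm y (List.mem_cons_of_mem _ hy)) hs
    have hcα' : α x = c + 1 := by simpa using hcα
    have hxm : x + 1 < m := hm _ (by simp)
    refine H.occursAt_substW_mid hp ho (x := List.replicate c 0) (y := z) ?_ ?_
    · rw [he, hcα', List.replicate_succ']; simp
    · rw [H.phi x hxm, hcα']; simp
  · obtain ⟨p, hp, ho, he⟩ := key a l hc hm hs
    refine H.occursAt_substW_mid hp ho he ?_
    rw [H.phi a (hm _ (by simp))]; simp

lemma chainsOccur_add (H : IsSimpleParry m α φ u) {s t : ℕ} (h : ChainsOccur m α φ u s t)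
    (d : ℕ) : ChainsOccur m α φ u (s + d) (t + d) := by
  induction d with
  | zero => exact h
  | succ d ih => exact H.chainsOccur_succ ih

lemma chainsOccur_zero (H : IsSimpleParry m α φ u)
    (h : ChainsOccur m α φ u (m - 1) (m - 1)) : ChainsOccur m α φ u 0 m := by
  have hm := H.two_le
  intro l hc _ hs
  rcases l with _ | ⟨a, l⟩
  · simp at hs
  have hle := head_add_length_le hc hs
  obtain rfl : a = 0 := by omega
  obtain rfl : l = [] := List.eq_nil_of_length_eq_zero (by omega)
  obtain ⟨p, hp, ho⟩ := h [m - 1] (by simp) (by simp; omega) (by simp)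
  obtain ⟨c, hcα⟩ := Nat.exists_eq_add_of_le' H.last_pos
  obtain ⟨z, hz, -⟩ := H.phi_zero
  have := H.occursAt_substW_mid hp ho (x := List.replicate c 0) (w := [0] ++ [0]) (y := z)
    (by simp [H.phi_last, hcα, hz, List.replicate_succ']) (by simp [H.phi_last, hcα])
  rwa [Nat.sub_add_cancel (by omega)] at this

lemma length_le_iterW (H : IsSimpleParry m α φ u) {p : ℕ} {v : List ℕ} (h : OccursAt u p v)
    (k : ℕ) : v.length ≤ (iterW φ k v).length := by
  induction k with
  | zero => simp
  | succ k ih =>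
    rw [iterW_succ]
    refine ih.trans (H.length_le_substW fun y hy => ?_)
    have h' : pref u _ ++ _ = pref u _ := H.occursAt_iterW h k
    exact H.mem_pref_lt (h' ▸ List.mem_append_right _ hy)

lemma length_iterW_pref_succ (k p : ℕ) :
    (iterW φ k (pref u (p + 1))).length =
      (iterW φ k (pref u p)).length + (iterW φ k [u p]).length := by
  simp [pref_add]

lemma exists_block (H : IsSimpleParry m α φ u) (k i : ℕ) :
    ∃ p o, (iterW φ k (pref u p)).length + o = i ∧ o < (iterW φ k [u p]).length := by
  have hpos : ∀ p, 0 < (iterW φ k [u p]).length := fun p =>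
    H.length_le_iterW (v := [u p]) (by simpa using occursAt_map_range u p 1) k
  induction i with
  | zero =>
    exact ⟨0, 0, by simp [pref], hpos 0⟩
  | succ i ih =>
    obtain ⟨p, o, ho, hlt⟩ := ih
    by_cases h : o + 1 < (iterW φ k [u p]).length
    · exact ⟨p, o + 1, by omega, h⟩
    · exact ⟨p + 1, 0, by rw [length_iterW_pref_succ]; omega, hpos _⟩

lemma occursAt_phi (H : IsSimpleParry m α φ u) (q : ℕ) :
    OccursAt u (substW φ (pref u q)).length (φ (u q)) := by
  have := H.occursAt_iterW (v := [u q]) (by simpa using occursAt_map_range u q 1) 1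
  simpa using this

lemma succeeds_of_ne_zero (H : IsSimpleParry m α φ u) (x : ℕ) :
    ∀ p, u (p + 1) = x → x ≠ 0 → Succeeds α (u p) x := by
  induction x with
  | zero => intro p _ h; exact absurd rfl h
  | succ x ih =>
    intro p hp _
    obtain ⟨q, o, ho, hlt⟩ := H.exists_block 1 (p + 1)
    simp only [iterW_one, substW_cons, substW_nil, List.append_nil] at ho hlt
    have hocc := H.occursAt_phi q
    have hx := hocc.getElem? hlt
    rw [ho, hp] at hx
    have hq : u q + 1 < m := by
      by_contra hq
      have hqm : u q = m - 1 := by have := H.lt q; omega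
      rw [hqm, H.phi_last] at hx
      have := List.mem_of_getElem? hx
      simp at this
    rw [H.phi _ hq] at hx hlt hocc
    have hoα : o = α (u q) := by
      by_contra hne
      have hl : o < α (u q) := by simp at hlt; omega
      rw [List.getElem?_append_left (by simpa using hl)] at hx
      simp [hl] at hx
    subst hoα
    obtain rfl : x = u q := by simpa using hx.symm
    rcases Nat.eq_zero_or_pos (α (u q)) with h0 | h0
    · rcases q with _ | q
      · simp [pref, h0] at ho
      have hlen := length_iterW_pref_succ (φ := φ) (u := u) 1 q
      simp only [iterW_one, substW_cons, substW_nil, List.append_nil] at hlen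
      have hx0 : u (q + 1) ≠ 0 := by
        intro h; have := H.zero_pos; rw [h] at h0; omega
      have hs := ih q rfl hx0
      have hb : u q + 1 < m := by have := hs.1; omega
      have hb' := H.occursAt_phi q
      rw [H.phi _ hb] at hb' hlen
      have hup := hb'.right.getElem? (i := 0) (by simp)
      simp only [List.length_append, List.length_replicate, List.length_singleton] at hlen hup
      rw [show (substW φ (pref u q)).length + α (u q) + 0 = p by omega] at hup
      have hup' : u p = u q + 1 := by simpa using hup.symm
      obtain ⟨h1, h2, h3⟩ := hs
      rw [hup']
      refine ⟨by omega, ?_, fun j hj hj' => ?_⟩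
      · rwa [show u (q + 1) + 1 - (u q + 1) - 1 = u (q + 1) - u q - 1 by omega]
      · rcases Nat.lt_succ_iff_lt_or_eq.1 hj' with h | h
        · exact h3 j (by omega) h
        · rwa [h]
    · have hup := hocc.getElem? (i := α (u q) - 1) (by simp)
      rw [List.getElem?_append_left (by simpa using h0),
        show (substW φ (pref u q)).length + (α (u q) - 1) = p by omega] at hup
      have hup' : u p = 0 := by
        simp [List.getElem?_replicate] at hup
        omega
      rw [hup']
      exact ⟨by omega, h0, fun j hj hj' => by omega⟩

lemma exists_chain (H : IsSimpleParry m α φ u) (p : ℕ) :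
    ∃ l, (u p :: l).IsChain (Succeeds α) ∧ OccursAt u p (u p :: l ++ [0]) := by
  induction h : m - u p using Nat.strong_induction_on generalizing p with
  | _ d ih =>
    by_cases h0 : u (p + 1) = 0
    · refine ⟨[], by simp, ?_⟩
      have := occursAt_map_range u p 2
      simpa [List.range_succ, h0] using this
    · have hs := H.succeeds_of_ne_zero _ p rfl h0
      have hlt := hs.1
      have := H.lt (p + 1)
      obtain ⟨l, hl, hl'⟩ := ih (m - u (p + 1)) (by omega) (p + 1) rfl
      refine ⟨u (p + 1) :: l, List.isChain_cons_cons.2 ⟨hs, hl⟩, ?_⟩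
      rw [List.cons_append, occursAt_cons]
      exact ⟨rfl, hl'⟩

/-- If every chain starts inside `φ^R(0)`, then every factor of length at most `|φ^k(0)|` starts
inside `φ^(k+R)(0)`. -/
lemma exists_occursAt_lt (H : IsSimpleParry m α φ u) {R : ℕ}
    (hR : ∀ s < m, ChainsOccur m α φ u s R) {n k i : ℕ} {w : List ℕ}
    (hn : w.length = n) (hk : n ≤ (iterW φ k [0]).length) (hw : OccursAt u i w) :
    ∃ j < (iterW φ (k + R) [0]).length, OccursAt u j w := by
  obtain ⟨p, o, ho, hlt⟩ := H.exists_block k i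
  obtain ⟨l, hl, hocc⟩ := H.exists_chain p
  have hmem : ∀ y ∈ u p :: l, y < m := fun y hy => by
    have h' : pref u _ ++ _ = pref u _ := hocc
    exact H.mem_pref_lt (h' ▸ List.mem_append_right _ (List.mem_append_left _ hy))
  obtain ⟨s, hs⟩ : ∃ s, (u p :: l).getLast? = some s :=
    ⟨_, List.getLast?_eq_some_getLast (by simp)⟩
  obtain ⟨p', hp', hocc'⟩ := hR s (hmem s (List.mem_of_getLast? hs)) _ hl hmem hs
  have h1 := H.occursAt_iterW hocc k
  have h2 := H.occursAt_iterW hocc' k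
  set W := iterW φ k (u p :: l ++ [0]) with hW
  have hlen : o + n ≤ W.length := by
    have : u p :: l ++ [0] = [u p] ++ l ++ [0] := by simp
    rw [hW, this, iterW_append, iterW_append]
    simp; omega
  have hsplit : W = W.take o ++ (W.drop o).take n ++ (W.drop o).drop n := by
    rw [List.append_assoc, List.take_append_drop, List.take_append_drop]
  have hto : (W.take o).length = o := by simp; omega
  rw [hsplit] at h1 h2
  have h1' := h1.mid
  have h2' := h2.mid
  rw [hto] at h1' h2'
  rw [ho] at h1'
  rw [hw.eq_of_length h1' (by simp; omega)]
  exact ⟨_, H.length_iterW_pref_lt (occursAt_cons.1 hocc').1 hp' k hlt, h2'⟩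

lemma iter_eq_range (H : IsSimpleParry m α φ u) {e : ℕ} (hem : e < m)
    (he : ∀ j, 1 ≤ j → j < e → α j = 0) (h1 : 1 ≤ e → α 0 = 1) :
    ∀ j ≤ e, iterW φ j [0] = List.range (j + 1) := by
  intro j
  induction j with
  | zero => intro _; rfl
  | succ j ih =>
    intro hj
    have key : ∀ i < e, substW φ (List.range (i + 1)) = List.range (i + 2) := by
      intro i
      induction i with
      | zero =>
        intro hi
        simp [List.range_succ, H.phi 0 (by omega), h1 (by omega)]
      | succ i ih' =>
        intro hi
        rw [List.range_succ, substW_append, ih' (by omega), List.range_succ (n := i + 2)]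
        simp [H.phi (i + 1) (by omega), he (i + 1) (by omega) hi]
    rw [iterW_succ, ih (by omega), key j (by omega)]

lemma chainsOccur_self {e : ℕ}
    (he : ∀ j, 1 ≤ j → j < e → α j = 0)
    (hiter : iterW φ e [0] = List.range (e + 1))
    (hocc : OccursAt u 0 (iterW φ e [0] ++ [0])) : ChainsOccur m α φ u e e := by
  intro l hc _ hs
  rcases l with _ | ⟨a, l⟩
  · simp at hs
  have hle := head_add_length_le hc hs
  refine ⟨a, by rw [hiter]; simp; omega, ?_⟩
  have hr : List.range (e + 1) = List.range a ++ (a :: l) := by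
    rw [eq_range' he hc hs, List.range_eq_range', List.range_eq_range']
    have := List.range'_append_1 (s := 0) (m := a) (n := e + 1 - a)
    rw [Nat.zero_add] at this
    rw [this]; congr 1; omega
  rw [hiter, hr, List.append_assoc] at hocc
  simpa using hocc.right

lemma chainsOccur_all (H : IsSimpleParry m α φ u) {e : ℕ} (hem : e < m)
    (h : ChainsOccur m α φ u e e) : ∀ s < m, ChainsOccur m α φ u s (m - 1 + e) := by
  intro s hs
  have hge : ∀ s, e ≤ s → ChainsOccur m α φ u s s := fun s hs => by
    have := H.chainsOccur_add h (s - e)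
    rwa [Nat.add_sub_cancel' hs] at this
  rcases Nat.lt_or_ge s e with hse | hse
  · have := H.chainsOccur_add (H.chainsOccur_zero (hge (m - 1) (by omega))) s
    rw [Nat.zero_add] at this
    exact H.chainsOccur_mono this (by omega)
  · exact H.chainsOccur_mono (hge s hse) (by omega)

/-- The main statement, given the length `e + 1` of the part of `u` preceding its second
occurrence of the letter `0`. -/
lemma factors_of_occursAt (H : IsSimpleParry m α φ u) {e : ℕ} (hem : e < m)
    (he : ∀ j, 1 ≤ j → j < e → α j = 0) (hiter : iterW φ e [0] = List.range (e + 1))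
    (hocc : OccursAt u 0 (iterW φ e [0] ++ [0])) {n k : ℕ}
    (hk : n ≤ (iterW φ k [0]).length) :
    (iterW φ (k + (m - 1 + e)) [0] ++ pref u n) =
      pref u (iterW φ (k + (m - 1 + e)) [0] ++ pref u n).length ∧
    (∀ w : List ℕ, IsFactor u w → w.length = n →
      w <:+: (iterW φ (k + (m - 1 + e)) [0] ++ pref u n)) := by
  have hpre : iterW φ (k + (m - 1 + e)) [0] ++ pref u n =
      pref u (iterW φ (k + (m - 1 + e)) [0] ++ pref u n).length := by
    have h := H.occursAt_iterW hocc (k + (m - 1))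
    rw [iterW_append, ← iterW_add, Nat.add_assoc] at h
    obtain ⟨t, ht⟩ : pref u n <+: iterW φ (k + (m - 1)) [0] := by
      rw [H.iter_eq]
      exact pref_prefix (hk.trans (H.length_iter_mono (Nat.le_add_right k (m - 1))))
    rw [← ht, ← List.append_assoc] at h
    have h' := h.left
    have h0 : (iterW φ (k + (m - 1)) (pref u 0)).length = 0 := by simp [pref]
    rw [h0] at h'
    exact occursAt_zero.1 h'
  refine ⟨hpre, fun w hw hwn => ?_⟩
  obtain ⟨i, hi⟩ := hw
  have hwi : OccursAt u i w := by rw [hi]; exact occursAt_map_range u i _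
  obtain ⟨j, hj, hjw⟩ := H.exists_occursAt_lt
    (H.chainsOccur_all hem (chainsOccur_self he hiter hocc)) hwn hk hwi
  rw [hpre]
  refine List.IsInfix.trans ⟨pref u j, [], ?_⟩
    (pref_prefix (a := j + w.length) (by simp; omega)).isInfix
  rw [List.append_nil]; exact hjw

lemma occursAt_zero_iter_append (H : IsSimpleParry m α φ u) {e : ℕ} (hem : e < m)
    (hα : 1 ≤ α e) (he0 : e = 0 → 2 ≤ α 0)
    (hiter : ∀ j ≤ e, iterW φ j [0] = List.range (j + 1)) :
    OccursAt u 0 (iterW φ e [0] ++ [0]) := by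
  suffices h : ∃ v, iterW φ (e + 1) [0] = iterW φ e [0] ++ [0] ++ v by
    obtain ⟨v, hv⟩ := h
    refine OccursAt.left (w := v) ?_
    rw [← hv]
    exact occursAt_zero.2 (H.iter_eq _)
  rcases e with _ | e
  · obtain ⟨c, hc⟩ := Nat.exists_eq_add_of_le' (he0 rfl)
    have := H.two_le
    exact ⟨List.replicate c 0 ++ [1], by
      simp [H.phi 0 (by omega), hc, List.replicate_succ]⟩
  · obtain ⟨v, hv⟩ := H.phi_eq_zero_cons hem hα
    refine ⟨v, ?_⟩
    have hs : substW φ (List.range (e + 1)) = List.range (e + 1 + 1) := by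
      rw [← hiter e (by omega), ← iterW_succ, hiter (e + 1) le_rfl]
    rw [iterW_succ, hiter (e + 1) le_rfl]
    nth_rw 1 [List.range_succ]
    rw [substW_append, hs]
    simp [hv]

end IsSimpleParry

end SimpleParryWord

theorem stmt10
    (m : ℕ) (hm : 2 ≤ m) (α : ℕ → ℕ) (hα0 : 1 ≤ α 0)
    (hαle : ∀ ℓ, ℓ < m → α ℓ ≤ α 0) (hαlast : 1 ≤ α (m - 1))
    (φ : ℕ → List ℕ)
    (hφ : ∀ ℓ, ℓ + 1 < m → φ ℓ = List.replicate (α ℓ) 0 ++ [ℓ + 1])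
    (hφlast : φ (m - 1) = List.replicate (α (m - 1)) 0)
    (u : ℕ → ℕ) (hu : ∀ i, u i < m)
    (hufix : ∀ k : ℕ, iterW φ k [0] = pref u (iterW φ k [0]).length)
    (R : ℕ)
    (hR : R = if 2 ≤ α 0 then m - 1 else m + sInf {ℓ : ℕ | 1 ≤ ℓ ∧ 1 ≤ α ℓ} - 1)
    (n k : ℕ) (hn : 1 ≤ n) (hk : n ≤ (iterW φ k [0]).length) :
    (iterW φ (k + R) [0] ++ pref u n) =
      pref u (iterW φ (k + R) [0] ++ pref u n).length ∧
    (∀ w : List ℕ, IsFactor u w → w.length = n →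
      w <:+: (iterW φ (k + R) [0] ++ pref u n)) := by
  have H : SimpleParryWord.IsSimpleParry m α φ u :=
    ⟨hm, hα0, hαlast, hφ, hφlast, hu, hufix⟩
  obtain ⟨e, hem, hα, he, he0, he1, rfl⟩ : ∃ e < m, 1 ≤ α e ∧ (∀ j, 1 ≤ j → j < e → α j = 0) ∧
      (e = 0 → 2 ≤ α 0) ∧ (1 ≤ e → α 0 = 1) ∧ R = m - 1 + e := by
    split_ifs at hR with h2
    · exact ⟨0, by omega, hα0, by omega, fun _ => h2, by omega, hR⟩
    · have hmem : m - 1 ∈ {ℓ : ℕ | 1 ≤ ℓ ∧ 1 ≤ α ℓ} := ⟨by omega, hαlast⟩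
      have hle := Nat.sInf_le hmem
      have hinf := Nat.sInf_mem ⟨_, hmem⟩
      refine ⟨_, by omega, hinf.2, fun j hj hj' => ?_, fun h => ?_, by omega, by omega⟩
      · by_contra hne
        exact Nat.notMem_of_lt_sInf hj' ⟨hj, by omega⟩
      · have := hinf.1
        omega
  have hiter := H.iter_eq_range hem he he1
  exact H.factors_of_occursAt hem he (hiter e le_rfl)
    (H.occursAt_zero_iter_append hem hα he0 hiter) hk
end
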